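/- For every x ≥ 0 and ε > 0, if τ_0^{(x+ε),−} < T_a^{(x+ε),+}, then L^{(x+ε)}(t) = L^{(x)}(t) for all t ∈ [0,∞), and R^{(x+ε)}(t) − R^{(x)}(t) = 0 for all t ∈ [0, τ_0^{(x),−}) while R^{(x+ε)}(t) − R^{(x)}(t) = −ε for all t ∈ [τ_0^{(x+ε),−}, ∞). -/

import Mathlib

open Filter Set

/-- A càdlàg function: right-continuous with left limits. -/
def CadlagFun (f : ℝ → ℝ) : Prop :=
  (∀ t : ℝ, ContinuousWithinAt f (Set.Ici t) t) ∧
  (∀ t : ℝ, ∃ l : ℝ, Tendsto f (nhdsWithin t (Set.Iio t)) (nhds l))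

/-- A strictly increasing sequence of times starting at `0` and tending to `∞`. -/
def IsTimeGrid (T : ℕ → ℝ) : Prop :=
  T 0 = 0 ∧ StrictMono T ∧ Tendsto T atTop atTop

/-- The periodic-classical reflected triple `(U, L, R)` of the path `t ↦ y + f t`:
classical reflection below at level `0`, periodic reflection above at level `a` at the
times `T k`, defined by the recursive specification. -/
structure IsPCTriple (a : ℝ) (T : ℕ → ℝ) (f : ℝ → ℝ) (y : ℝ)
    (U L R : ℝ → ℝ) : Prop where
  L_first : ∀ t : ℝ, 0 ≤ t → t < T 1 → L t = 0
  R_first : ∀ t : ℝ, 0 ≤ t → t < T 1 →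
    R t = max 0 (-sInf ((fun s => y + f s) '' Set.Icc 0 t))
  U_first : ∀ t : ℝ, 0 ≤ t → t < T 1 → U t = y + f t + R t
  R_seg : ∀ (k : ℕ) (t : ℝ), T k < t → t < T (k + 1) →
    R t = R (T k) + max 0 (-sInf ((fun s => U (T k) + f s - f (T k)) '' Set.Icc (T k) t))
  U_seg : ∀ (k : ℕ) (t : ℝ), T k < t → t < T (k + 1) →
    U t = (U (T k) + f t - f (T k)) + (R t - R (T k))
  L_seg : ∀ (k : ℕ) (t : ℝ), T k < t → t < T (k + 1) → L t = L (T k)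
  R_jump : ∀ k : ℕ, R (T (k + 1)) = R (T k) +
    max 0 (-sInf ((fun s => U (T k) + f s - f (T k)) '' Set.Icc (T k) (T (k + 1))))
  L_jump : ∀ k : ℕ, L (T (k + 1)) = L (T k) +
    max (((U (T k) + f (T (k + 1)) - f (T k)) + (R (T (k + 1)) - R (T k))) - a) 0
  U_jump : ∀ k : ℕ, U (T (k + 1)) =
    min ((U (T k) + f (T (k + 1)) - f (T k)) + (R (T (k + 1)) - R (T k))) a

/-- `τ_0^{(y),-} = inf {t ≥ 0 : y + f t < 0}`, with `inf ∅ = +∞`, as an extended real. -/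
noncomputable def tauMinus (f : ℝ → ℝ) (y : ℝ) : EReal :=
  sInf ((fun t : ℝ => (t : EReal)) '' {t : ℝ | 0 ≤ t ∧ y + f t < 0})

/-- `T_a^{(y),+} = inf {T k : k ≥ 1, y + f (T k) > a}`, with `inf ∅ = +∞`. -/
noncomputable def TPlus (a : ℝ) (T : ℕ → ℝ) (f : ℝ → ℝ) (y : ℝ) : EReal :=
  sInf ((fun t : ℝ => (t : EReal)) ''
    {t : ℝ | ∃ k : ℕ, 1 ≤ k ∧ t = T k ∧ a < y + f (T k)})

/-- A function with finite one-sided limits is bounded below on compact intervals. -/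
theorem CadlagFun.bddBelow_image_Icc {f : ℝ → ℝ} (hf : CadlagFun f) (u v : ℝ) :
    BddBelow (f '' Icc u v) := by
  refine isCompact_Icc.induction_on (p := fun s => BddBelow (f '' s)) (by simp)
    (fun s t hst ht => ht.mono (image_mono hst))
    (fun s t hs ht => by rw [image_union]; exact hs.union ht) ?_
  intro t _
  obtain ⟨l, hl⟩ := hf.2 t
  have h1 : ∀ᶠ s in nhdsWithin t (Iio t), min (l - 1) (f t - 1) < f s :=
    hl.eventually (lt_mem_nhds ((min_le_left _ _).trans_lt (by linarith)))
  have h2 : ∀ᶠ s in nhdsWithin t (Ici t), min (l - 1) (f t - 1) < f s :=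
    (hf.1 t).eventually (lt_mem_nhds ((min_le_right _ _).trans_lt (by linarith)))
  have h3 : ∀ᶠ s in nhds t, min (l - 1) (f t - 1) < f s := by
    rw [← nhdsLT_sup_nhdsGE]
    exact eventually_sup.2 ⟨h1, h2⟩
  refine ⟨_, mem_nhdsWithin_of_mem_nhds h3, min (l - 1) (f t - 1), ?_⟩
  rintro _ ⟨s, hs, rfl⟩
  exact le_of_lt hs

theorem sInf_image_const_add {f : ℝ → ℝ} {S : Set ℝ} (hS : S.Nonempty)
    (hb : BddBelow (f '' S)) (c : ℝ) :
    sInf ((fun s => c + f s) '' S) = c + sInf (f '' S) := by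
  have h := (OrderIso.addLeft c).map_csInf' (hS.image f) hb
  rw [image_image] at h
  exact h.symm

/-- The running infimum of `f` on `[0, t]`. -/
noncomputable def runningInf (f : ℝ → ℝ) (t : ℝ) : ℝ := sInf (f '' Icc 0 t)

theorem CadlagFun.runningInf_le {f : ℝ → ℝ} (hf : CadlagFun f) {s t : ℝ} (hs : 0 ≤ s)
    (hst : s ≤ t) : runningInf f t ≤ f s :=
  csInf_le (hf.bddBelow_image_Icc 0 t) ⟨s, ⟨hs, hst⟩, rfl⟩

theorem le_runningInf {f : ℝ → ℝ} {t c : ℝ} (ht : 0 ≤ t)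
    (h : ∀ s, 0 ≤ s → s ≤ t → c ≤ f s) : c ≤ runningInf f t := by
  refine le_csInf ((nonempty_Icc.2 ht).image f) ?_
  rintro _ ⟨s, hs, rfl⟩
  exact h s hs.1 hs.2

theorem CadlagFun.runningInf_eq_min {f : ℝ → ℝ} (hf : CadlagFun f) {s t : ℝ} (hs : 0 ≤ s)
    (hst : s ≤ t) : runningInf f t = min (runningInf f s) (sInf (f '' Icc s t)) := by
  rw [runningInf, runningInf, ← Icc_union_Icc_eq_Icc hs hst, image_union]
  exact csInf_union (hf.bddBelow_image_Icc 0 s) ((nonempty_Icc.2 hs).image f)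
    (hf.bddBelow_image_Icc s t) ((nonempty_Icc.2 hst).image f)

/-- Restarting the lower reflection at time `s` agrees with reflecting from time `0`. -/
theorem CadlagFun.reflection_restart {f : ℝ → ℝ} (hf : CadlagFun f) {s t y u r : ℝ}
    (hs : 0 ≤ s) (hst : s ≤ t) (hu : u = y + f s + r)
    (hr : r = max 0 (-(y + runningInf f s))) :
    r + max 0 (-sInf ((fun v => u + f v - f s) '' Icc s t)) =
      max 0 (-(y + runningInf f t)) := by
  have h : (fun v => u + f v - f s) = fun v => (y + r) + f v := by
    funext v
    rw [hu]
    ring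
  rw [h, sInf_image_const_add (nonempty_Icc.2 hst) (hf.bddBelow_image_Icc s t),
    hf.runningInf_eq_min hs hst, hr]
  grind

theorem IsTimeGrid.nonneg {T : ℕ → ℝ} (hT : IsTimeGrid T) (k : ℕ) : 0 ≤ T k := by
  rw [← hT.1]
  exact hT.2.1.monotone (Nat.zero_le k)

theorem IsTimeGrid.exists_mem_Ico {T : ℕ → ℝ} (hT : IsTimeGrid T) {t : ℝ} (ht : 0 ≤ t) :
    ∃ k, T k ≤ t ∧ t < T (k + 1) := by
  have hex : ∃ n, t < T n := (hT.2.2.eventually_gt_atTop t).exists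
  classical
  obtain ⟨k, hk⟩ : ∃ k, Nat.find hex = k + 1 := by
    refine Nat.exists_eq_succ_of_ne_zero fun h => ?_
    have := Nat.find_spec hex
    rw [h, hT.1] at this
    linarith
  refine ⟨k, not_lt.1 (Nat.find_min hex (by omega)), ?_⟩
  rw [← hk]
  exact Nat.find_spec hex

namespace IsPCTriple

variable {a : ℝ} {T : ℕ → ℝ} {f : ℝ → ℝ} {y : ℝ} {U L R : ℝ → ℝ}

/-- As long as the path reflected only at `0` does not exceed `a` at grid times, the triple
coincides with the one reflected only at `0`. -/
theorem eq_of_le_at_grid (h : IsPCTriple a T f y U L R) (hT : IsTimeGrid T)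
    (hf : CadlagFun f) (k : ℕ)
    (hle : ∀ j, 1 ≤ j → j ≤ k → y + f (T j) + max 0 (-(y + runningInf f (T j))) ≤ a) :
    U (T k) = y + f (T k) + R (T k) ∧ R (T k) = max 0 (-(y + runningInf f (T k))) ∧
      L (T k) = 0 := by
  induction k with
  | zero =>
    have h1 : (0 : ℝ) < T 1 := hT.1 ▸ hT.2.1 Nat.zero_lt_one
    rw [hT.1]
    refine ⟨h.U_first 0 le_rfl h1, ?_, h.L_first 0 le_rfl h1⟩
    rw [h.R_first 0 le_rfl h1, sInf_image_const_add (nonempty_Icc.2 le_rfl)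
      (hf.bddBelow_image_Icc 0 0), runningInf]
  | succ k ih =>
    obtain ⟨hU, hR, hL⟩ := ih fun j h1 h2 => hle j h1 (by omega)
    have hR' : R (T (k + 1)) = max 0 (-(y + runningInf f (T (k + 1)))) := by
      rw [h.R_jump, hf.reflection_restart (hT.nonneg k) (hT.2.1.monotone (Nat.le_succ k)) hU hR]
    have ha := hle (k + 1) (by omega) le_rfl
    rw [← hR'] at ha
    have hp : U (T k) + f (T (k + 1)) - f (T k) + (R (T (k + 1)) - R (T k)) =
        y + f (T (k + 1)) + R (T (k + 1)) := by
      rw [hU]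
      ring
    refine ⟨?_, hR', ?_⟩
    · rw [h.U_jump, hp, min_eq_left ha]
    · rw [h.L_jump, hp, hL, max_eq_right (by linarith), add_zero]

theorem L_eq_of_mem_Ico (h : IsPCTriple a T f y U L R) {k : ℕ} {t : ℝ} (h1 : T k ≤ t)
    (h2 : t < T (k + 1)) : L t = L (T k) := by
  rcases h1.eq_or_lt with rfl | h1
  · rfl
  · exact h.L_seg k t h1 h2

theorem R_eq_of_mem_Ico (h : IsPCTriple a T f y U L R) (hT : IsTimeGrid T) (hf : CadlagFun f)
    {k : ℕ} {t : ℝ} (hU : U (T k) = y + f (T k) + R (T k))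
    (hR : R (T k) = max 0 (-(y + runningInf f (T k)))) (h1 : T k ≤ t) (h2 : t < T (k + 1)) :
    R t = max 0 (-(y + runningInf f t)) := by
  rcases h1.eq_or_lt with rfl | h1
  · exact hR
  · rw [h.R_seg k t h1 h2, hf.reflection_restart (hT.nonneg k) h1.le hU hR]

/-- Two triples that agree at a grid time, up to a constant shift of `R`, do so afterwards. -/
theorem eq_of_eq_at_grid {y' : ℝ} {U' L' R' : ℝ → ℝ} (h : IsPCTriple a T f y U L R)
    (h' : IsPCTriple a T f y' U' L' R') {c : ℝ} {K : ℕ} (hU : U' (T K) = U (T K))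
    (hL : L' (T K) = L (T K)) (hR : R' (T K) - R (T K) = c) {k : ℕ} (hk : K ≤ k) :
    U' (T k) = U (T k) ∧ L' (T k) = L (T k) ∧ R' (T k) - R (T k) = c := by
  induction k, hk using Nat.le_induction with
  | base => exact ⟨hU, hL, hR⟩
  | succ k _ ih =>
    obtain ⟨hU, hL, hR⟩ := ih
    have hR' : R' (T (k + 1)) - R' (T k) = R (T (k + 1)) - R (T k) := by
      rw [h.R_jump, h'.R_jump, hU]
      ring
    refine ⟨?_, ?_, by linarith⟩
    · rw [h.U_jump, h'.U_jump, hU, hR']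
    · rw [h.L_jump, h'.L_jump, hU, hR', hL]

theorem R_sub_eq_of_mem_Ico {y' : ℝ} {U' L' R' : ℝ → ℝ} (h : IsPCTriple a T f y U L R)
    (h' : IsPCTriple a T f y' U' L' R') {c : ℝ} {k : ℕ} (hU : U' (T k) = U (T k))
    (hR : R' (T k) - R (T k) = c) {t : ℝ} (h1 : T k ≤ t) (h2 : t < T (k + 1)) :
    R' t - R t = c := by
  rcases h1.eq_or_lt with rfl | h1
  · exact hR
  · rw [h.R_seg k t h1 h2, h'.R_seg k t h1 h2, hU]
    linarith

end IsPCTriple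

theorem nonneg_of_lt_tauMinus {f : ℝ → ℝ} {y s : ℝ} (hs : 0 ≤ s)
    (h : (s : EReal) < tauMinus f y) : 0 ≤ y + f s := by
  by_contra! hc
  exact absurd h (not_lt.2 (sInf_le ⟨s, ⟨hs, hc⟩, rfl⟩))

theorem tauMinus_nonneg (f : ℝ → ℝ) (y : ℝ) : 0 ≤ tauMinus f y := by
  refine le_sInf ?_
  rintro _ ⟨s, hs, rfl⟩
  exact EReal.coe_nonneg.2 hs.1

theorem tauMinus_mono (f : ℝ → ℝ) : Monotone (tauMinus f) := by
  intro y z hyz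
  refine sInf_le_sInf (image_mono ?_)
  rintro s ⟨hs, h⟩
  exact ⟨hs, by linarith⟩

/-- By right-continuity the path is nonpositive at its first passage time below `0`. -/
theorem CadlagFun.nonpos_at_tauMinus {f : ℝ → ℝ} (hf : CadlagFun f) {y τ : ℝ}
    (hτ : tauMinus f y = τ) : y + f τ ≤ 0 := by
  by_contra! hc
  have h1 : ∀ᶠ s in nhdsWithin τ (Ici τ), -y < f s :=
    (hf.1 τ).eventually (lt_mem_nhds (by linarith))
  obtain ⟨u, hu, hsub⟩ := mem_nhdsGE_iff_exists_Ico_subset.1 h1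
  have h2 : (u : EReal) ≤ tauMinus f y := by
    refine le_sInf ?_
    rintro _ ⟨s, ⟨hs0, hs⟩, rfl⟩
    refine EReal.coe_le_coe_iff.2 ?_
    by_contra! hsu
    rcases lt_or_ge s τ with hsτ | hsτ
    · have := nonneg_of_lt_tauMinus hs0 (hτ ▸ EReal.coe_lt_coe_iff.2 hsτ)
      linarith
    · have : -y < f s := hsub ⟨hsτ, hsu⟩
      linarith
  rw [hτ] at h2
  exact absurd (EReal.coe_le_coe_iff.1 h2) (not_le.2 hu)

theorem le_of_lt_TPlus {a : ℝ} {T : ℕ → ℝ} {f : ℝ → ℝ} {y : ℝ} {k : ℕ} (hk : 1 ≤ k)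
    (h : (T k : EReal) < TPlus a T f y) : y + f (T k) ≤ a := by
  by_contra! hc
  exact absurd h (not_lt.2 (sInf_le ⟨T k, ⟨k, hk, rfl, hc⟩, rfl⟩))

/-- If `τ_0^{(x+ε),-} < T_a^{(x+ε),+}`, then `L⁽ˣ⁺ᵉ⁾ = L⁽ˣ⁾` on `[0,∞)`,
`R⁽ˣ⁺ᵉ⁾ - R⁽ˣ⁾ = 0` on `[0, τ_0^{(x),-})` and `R⁽ˣ⁺ᵉ⁾ - R⁽ˣ⁾ = -ε` on `[τ_0^{(x+ε),-}, ∞)`. -/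
theorem stmt6
    (a : ℝ) (ha : 0 ≤ a) (T : ℕ → ℝ) (hT : IsTimeGrid T)
    (f : ℝ → ℝ) (hf : CadlagFun f) (hf0 : f 0 = 0)
    (hfT : ∀ k : ℕ, 1 ≤ k → ContinuousAt f (T k))
    (x ε : ℝ) (hx : 0 ≤ x) (hε : 0 < ε)
    (U L R Ue Le Re : ℝ → ℝ)
    (hx_triple : IsPCTriple a T f x U L R)
    (hxe_triple : IsPCTriple a T f (x + ε) Ue Le Re)
    (horder : tauMinus f (x + ε) < TPlus a T f (x + ε)) :
    (∀ t : ℝ, 0 ≤ t → Le t = L t) ∧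
    (∀ t : ℝ, 0 ≤ t → (t : EReal) < tauMinus f x → Re t - R t = 0) ∧
    (∀ t : ℝ, tauMinus f (x + ε) ≤ (t : EReal) → Re t - R t = -ε) := by
  obtain ⟨τ, hτ⟩ : ∃ τ : ℝ, tauMinus f (x + ε) = τ :=
    ⟨_, (EReal.coe_toReal horder.ne_top
      (ne_of_gt (EReal.bot_lt_zero.trans_le (tauMinus_nonneg f (x + ε))))).symm⟩
  have hτ0 : 0 ≤ τ := EReal.coe_nonneg.1 (hτ ▸ tauMinus_nonneg f (x + ε))
  have hfτ : x + ε + f τ ≤ 0 := hf.nonpos_at_tauMinus hτ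
  have hpos : ∀ s, 0 ≤ s → s < τ → 0 ≤ x + ε + f s := fun s hs hsτ =>
    nonneg_of_lt_tauMinus hs (hτ ▸ EReal.coe_lt_coe_iff.2 hsτ)
  obtain ⟨K, hK1, hK2⟩ := hT.exists_mem_Ico hτ0
  have hgrid : ∀ y, y ≤ x + ε → ∀ j, 1 ≤ j → j ≤ K →
      y + f (T j) + max 0 (-(y + runningInf f (T j))) ≤ a := by
    intro y hy j hj hjK
    have hjτ : T j ≤ τ := (hT.2.1.monotone hjK).trans hK1
    have hja : x + ε + f (T j) ≤ a :=
      le_of_lt_TPlus hj ((EReal.coe_le_coe_iff.2 hjτ).trans_lt (hτ ▸ horder))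
    rcases hjτ.eq_or_lt with hjτ | hjτ
    · have hm : min (-(x + ε)) (f τ) ≤ runningInf f τ := by
        refine le_runningInf hτ0 fun s hs hsτ => ?_
        rcases hsτ.eq_or_lt with rfl | hsτ
        · exact min_le_right _ _
        · exact (min_le_left _ _).trans (by linarith [hpos s hs hsτ])
      rw [min_eq_right (by linarith)] at hm
      rw [hjτ] at hja ⊢
      grind
    · have hm : -(x + ε) ≤ runningInf f (T j) :=
        le_runningInf (hT.nonneg j) fun s hs hsj => by
          linarith [hpos s hs (hsj.trans_lt hjτ)]
      grind
  have hX : ∀ k, k ≤ K → _ := fun k hk => hx_triple.eq_of_le_at_grid hT hf k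
    fun j h1 h2 => hgrid x (by linarith) j h1 (h2.trans hk)
  have hXe : ∀ k, k ≤ K → _ := fun k hk => hxe_triple.eq_of_le_at_grid hT hf k
    fun j h1 h2 => hgrid (x + ε) le_rfl j h1 (h2.trans hk)
  have hdiff : ∀ t, τ ≤ t →
      max 0 (-(x + ε + runningInf f t)) = max 0 (-(x + runningInf f t)) - ε := by
    intro t ht
    have := hf.runningInf_le hτ0 ht
    rw [max_eq_right (by linarith), max_eq_right (by linarith)]
    ring
  obtain ⟨hU, hR, hL⟩ := hX K le_rfl
  obtain ⟨hUe, hRe, hLe⟩ := hXe K le_rfl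
  have hKle : T K ≤ T (K + 1) := hT.2.1.monotone (Nat.le_succ K)
  have hR1 : Re (T (K + 1)) = R (T (K + 1)) - ε := by
    rw [hx_triple.R_jump, hxe_triple.R_jump,
      hf.reflection_restart (hT.nonneg K) hKle hU hR,
      hf.reflection_restart (hT.nonneg K) hKle hUe hRe, hdiff _ hK2.le]
  have hp : Ue (T K) + f (T (K + 1)) - f (T K) + (Re (T (K + 1)) - Re (T K)) =
      U (T K) + f (T (K + 1)) - f (T K) + (R (T (K + 1)) - R (T K)) := by
    rw [hU, hUe, hR1]
    ring
  have hafter : ∀ k, K + 1 ≤ k → _ := fun k hk =>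
    hx_triple.eq_of_eq_at_grid hxe_triple
      (by rw [hx_triple.U_jump, hxe_triple.U_jump, hp])
      (by rw [hx_triple.L_jump, hxe_triple.L_jump, hp, hL, hLe])
      (show Re (T (K + 1)) - R (T (K + 1)) = -ε by linarith) hk
  refine ⟨fun t ht => ?_, fun t ht htτ => ?_, fun t htτ => ?_⟩
  · obtain ⟨k, hk1, hk2⟩ := hT.exists_mem_Ico ht
    rw [hx_triple.L_eq_of_mem_Ico hk1 hk2, hxe_triple.L_eq_of_mem_Ico hk1 hk2]
    rcases Nat.lt_or_ge K k with hk | hk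
    · exact (hafter k hk).2.1
    · rw [(hX k hk).2.2, (hXe k hk).2.2]
  · have htτ' : t < τ := EReal.coe_lt_coe_iff.1
      (hτ ▸ htτ.trans_le (tauMinus_mono f (by linarith)))
    obtain ⟨k, hk1, hk2⟩ := hT.exists_mem_Ico ht
    have hk : k ≤ K := by
      have := hT.2.1.lt_iff_lt.1 (hk1.trans_lt (htτ'.trans hK2))
      omega
    have hm : -x ≤ runningInf f t := le_runningInf ht fun s hs hst => by
      linarith [nonneg_of_lt_tauMinus hs ((EReal.coe_le_coe_iff.2 hst).trans_lt htτ)]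
    rw [hx_triple.R_eq_of_mem_Ico hT hf (hX k hk).1 (hX k hk).2.1 hk1 hk2,
      hxe_triple.R_eq_of_mem_Ico hT hf (hXe k hk).1 (hXe k hk).2.1 hk1 hk2,
      max_eq_left (by linarith), max_eq_left (by linarith), sub_zero]
  · have htτ' : τ ≤ t := EReal.coe_le_coe_iff.1 (hτ ▸ htτ)
    obtain ⟨k, hk1, hk2⟩ := hT.exists_mem_Ico (hτ0.trans htτ')
    have hKk : K ≤ k := by
      have := hT.2.1.lt_iff_lt.1 (hK1.trans_lt (htτ'.trans_lt hk2))
      omega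
    rcases hKk.eq_or_lt with rfl | hk
    · rw [hx_triple.R_eq_of_mem_Ico hT hf hU hR hk1 hk2,
        hxe_triple.R_eq_of_mem_Ico hT hf hUe hRe hk1 hk2, hdiff t htτ']
      ring
    · exact hx_triple.R_sub_eq_of_mem_Ico hxe_triple (hafter k hk).1 (hafter k hk).2.2 hk1 hk2
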